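/- arXiv:2109.08962 — 12 statements merged into one kernel-verified Lean document; each statement's English description precedes it below -/
import Mathlib

section
/- A 2×2 integer matrix M is equal to a product of a nonempty finite sequence of matrices each of which is Φ₀ or Φ₁ and has determinant 1 if and only if M has the form !![p', p''; q', q''] with 1 ≤ p' ≤ q', 0 ≤ p'' < q'' and p'·q'' − p''·q' = 1. -/
/-- Φ₀ and Φ₁, the inverse branches of the Farey map written as matrices. -/
noncomputable def Phi0 : Matrix (Fin 2) (Fin 2) ℤ := !![0, 1; 1, 1]

noncomputable def Phi1 : Matrix (Fin 2) (Fin 2) ℤ := !![1, 0; 1, 1]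

theorem Phi0_mul (a b c d : ℤ) : Phi0 * !![a, b; c, d] = !![c, d; a + c, b + d] := by
  simp [Phi0]

theorem Phi1_mul (a b c d : ℤ) : Phi1 * !![a, b; c, d] = !![a, b; a + c, b + d] := by
  simp [Phi1]

theorem exists_entries_prod (L : List (Matrix (Fin 2) (Fin 2) ℤ)) (hne : L ≠ [])
    (hL : ∀ A ∈ L, A = Phi0 ∨ A = Phi1) :
    ∃ a b c d : ℤ, L.prod = !![a, b; c, d] ∧
      0 ≤ a ∧ a ≤ c ∧ 0 ≤ b ∧ b ≤ d ∧ 1 ≤ c ∧ 1 ≤ d := by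
  induction L with
  | nil => exact absurd rfl hne
  | cons A L ih =>
    obtain ⟨hA, hL⟩ := List.forall_mem_cons.mp hL
    rcases eq_or_ne L [] with rfl | hL'
    · rcases hA with rfl | rfl
      · exact ⟨0, 1, 1, 1, by simp [Phi0], by norm_num⟩
      · exact ⟨1, 0, 1, 1, by simp [Phi1], by norm_num⟩
    · obtain ⟨a, b, c, d, h, hab⟩ := ih hL' hL
      rcases hA with rfl | rfl
      · exact ⟨c, d, a + c, b + d, by rw [List.prod_cons, h, Phi0_mul], by omega⟩
      · exact ⟨a, b, a + c, b + d, by rw [List.prod_cons, h, Phi1_mul], by omega⟩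

/-- Nonnegative unimodular matrices other than the two permutation matrices have
comparable rows. -/
theorem rows_comparable {a b e f : ℤ} (ha : 0 ≤ a) (hb : 0 ≤ b) (he : 0 ≤ e) (hf : 0 ≤ f)
    (hdet : a * f - b * e = 1 ∨ a * f - b * e = -1) :
    (a ≤ e ∧ b ≤ f) ∨ (e ≤ a ∧ f ≤ b) ∨ (a = 0 ∧ b = 1 ∧ e = 1 ∧ f = 0) ∨
      (a = 1 ∧ b = 0 ∧ e = 0 ∧ f = 1) := by
  rcases le_or_gt a e with h1 | h1 <;> rcases le_or_gt b f with h2 | h2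
  · omega
  · rcases h1.eq_or_lt with rfl | h1
    · omega
    have : a + f + 1 ≤ b * e - a * f := by nlinarith
    have ha0 : a = 0 := by omega
    have hf0 : f = 0 := by omega
    subst ha0 hf0
    have hbe : b * e = 1 := by omega
    have := Int.eq_one_or_neg_one_of_mul_eq_one' hbe
    omega
  · rcases h2.eq_or_lt with rfl | h2
    · omega
    have : b + e + 1 ≤ a * f - b * e := by nlinarith
    have hb0 : b = 0 := by omega
    have he0 : e = 0 := by omega
    subst hb0 he0
    have haf : a * f = 1 := by omega
    have := Int.eq_one_or_neg_one_of_mul_eq_one' haf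
    omega
  · omega

theorem exists_list_prod_eq (n : ℕ) (a b c d : ℤ) (hn : c + d ≤ n)
    (ha : 0 ≤ a) (hac : a ≤ c) (hb : 0 ≤ b) (hbd : b ≤ d) (hc : 1 ≤ c) (hd : 1 ≤ d)
    (hdet : a * d - b * c = 1 ∨ a * d - b * c = -1) :
    ∃ L : List (Matrix (Fin 2) (Fin 2) ℤ),
      L ≠ [] ∧ (∀ A ∈ L, A = Phi0 ∨ A = Phi1) ∧ !![a, b; c, d] = L.prod := by
  induction n generalizing a b c d with
  | zero => omega
  | succ n ih =>
    obtain ⟨e, rfl⟩ : ∃ e, c = a + e := ⟨c - a, by ring⟩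
    obtain ⟨f, rfl⟩ : ∃ f, d = b + f := ⟨d - b, by ring⟩
    have hdet' : a * f - b * e = 1 ∨ a * f - b * e = -1 := by
      convert hdet using 2 <;> ring
    have hrow₁ : 1 ≤ a + b := by
      by_contra h
      obtain ⟨rfl, rfl⟩ : a = 0 ∧ b = 0 := by omega
      simp at hdet'
    have hrow₂ : 1 ≤ e + f := by
      by_contra h
      obtain ⟨rfl, rfl⟩ : e = 0 ∧ f = 0 := by omega
      simp at hdet'
    have hcol₁ : 1 ≤ a ∨ 1 ≤ e := by omega
    have hcol₂ : 1 ≤ b ∨ 1 ≤ f := by omega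
    push_cast at hn
    rcases rows_comparable ha hb (by omega) (by omega) hdet' with
      h | h | ⟨rfl, rfl, rfl, rfl⟩ | ⟨rfl, rfl, rfl, rfl⟩
    · obtain ⟨L, -, hL, hprod⟩ := ih a b e f (by omega) ha h.1 hb h.2 (by omega) (by omega) hdet'
      refine ⟨Phi1 :: L, by simp, by simpa using hL, ?_⟩
      rw [List.prod_cons, ← hprod, Phi1_mul]
    · obtain ⟨L, -, hL, hprod⟩ := ih e f a b (by omega) (by omega) h.1 (by omega) h.2
        (by omega) (by omega) (by rcases hdet' with h | h
                                  · right; linarith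
                                  · left; linarith)
      refine ⟨Phi0 :: L, by simp, by simpa using hL, ?_⟩
      rw [List.prod_cons, ← hprod, Phi0_mul, add_comm e, add_comm f]
    · exact ⟨[Phi0], by simp, by simp, by simp [Phi0]⟩
    · exact ⟨[Phi1], by simp, by simp, by simp [Phi1]⟩

/-- A 2×2 integer matrix `M` is a product of a nonempty finite sequence of matrices,
each of which is `Φ₀` or `Φ₁`, and has determinant `1`, if and only if
`M = !![p', p''; q', q'']` with `1 ≤ p' ≤ q'`, `0 ≤ p'' < q''` and `p'·q'' − p''·q' = 1`. -/
theorem farey_matrix_characterization (M : Matrix (Fin 2) (Fin 2) ℤ) :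
    ((∃ L : List (Matrix (Fin 2) (Fin 2) ℤ),
        L ≠ [] ∧ (∀ A ∈ L, A = Phi0 ∨ A = Phi1) ∧ M = L.prod) ∧ M.det = 1) ↔
    ∃ p' p'' q' q'' : ℤ, M = !![p', p''; q', q''] ∧
      1 ≤ p' ∧ p' ≤ q' ∧ 0 ≤ p'' ∧ p'' < q'' ∧ p' * q'' - p'' * q' = 1 := by
  constructor
  · rintro ⟨⟨L, hne, hL, rfl⟩, hdet⟩
    obtain ⟨a, b, c, d, h, ha, hac, hb, hbd, hc, hd⟩ := exists_entries_prod L hne hL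
    rw [h, Matrix.det_fin_two_of] at hdet
    refine ⟨a, b, c, d, h, ?_, hac, hb, ?_, hdet⟩
    · by_contra! ha'
      nlinarith
    · by_contra! hb'
      nlinarith
  · rintro ⟨a, b, c, d, rfl, ha, hac, hb, hbd, hdet⟩
    refine ⟨exists_list_prod_eq (c + d).toNat a b c d (by omega) (by omega) hac hb hbd.le
      (by omega) (by omega) (Or.inl hdet), ?_⟩
    rw [Matrix.det_fin_two_of, hdet]
end

section
/- Let n ≥ 2 and let (n₁, n₂, k₁, k₂) be positive integers with n₁ > n₂ and k₁·n₁ + k₂·n₂ = n. Then there exist an integer r with 1 ≤ r < n and gcd(r, n) = 1 and an integer m ≥ 1 such that the m-th iterate of F̃ applied to (n, r, 1, 0) equals (n₁, n₂, k₁, k₂), if and only if gcd(n₁, n₂) = 1 and gcd(k₁, k₂) = 1. -/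
/-- The extended Farey map on quadruples `(n₁, n₂, k₁, k₂)` of natural numbers. -/
def Ftilde : ℕ × ℕ × ℕ × ℕ → ℕ × ℕ × ℕ × ℕ := fun q =>
  if q.1 ≤ 2 * q.2.1 then (q.2.1, q.1 - q.2.1, q.2.2.1 + q.2.2.2, q.2.2.1)
  else (q.1 - q.2.1, q.2.1, q.2.2.1, q.2.2.1 + q.2.2.2)

/-- `Ftilde` preserves coprimality of the parts and of the multiplicities. -/
theorem Ftilde_coprime {q : ℕ × ℕ × ℕ × ℕ} (hle : q.2.1 ≤ q.1) (hp : Nat.Coprime q.1 q.2.1)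
    (hk : Nat.Coprime q.2.2.1 q.2.2.2) :
    (Ftilde q).2.1 ≤ (Ftilde q).1 ∧ Nat.Coprime (Ftilde q).1 (Ftilde q).2.1 ∧
      Nat.Coprime (Ftilde q).2.2.1 (Ftilde q).2.2.2 := by
  obtain ⟨a, b, c, d⟩ := q
  dsimp only at hle hp hk
  obtain ⟨e, rfl⟩ := Nat.exists_eq_add_of_le hle
  have hbe : Nat.Coprime b e := by simpa [Nat.coprime_comm] using hp
  unfold Ftilde
  dsimp only
  split_ifs with h
  · refine ⟨by dsimp only; omega, ?_, ?_⟩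
    · simpa using hbe
    · simpa [Nat.coprime_comm] using hk
  · refine ⟨by dsimp only; omega, ?_, ?_⟩
    · simpa [Nat.coprime_comm] using hbe
    · simpa using hk

theorem Ftilde_iterate_coprime {q : ℕ × ℕ × ℕ × ℕ} (hle : q.2.1 ≤ q.1)
    (hp : Nat.Coprime q.1 q.2.1) (hk : Nat.Coprime q.2.2.1 q.2.2.2) (m : ℕ) :
    (Ftilde^[m] q).2.1 ≤ (Ftilde^[m] q).1 ∧
      Nat.Coprime (Ftilde^[m] q).1 (Ftilde^[m] q).2.1 ∧
      Nat.Coprime (Ftilde^[m] q).2.2.1 (Ftilde^[m] q).2.2.2 := by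
  induction m with
  | zero => exact ⟨hle, hp, hk⟩
  | succ m ih =>
    rw [Function.iterate_succ_apply']
    exact Ftilde_coprime ih.1 ih.2.1 ih.2.2

theorem Ftilde_add_left {a b c d : ℕ} (h : b ≤ a) :
    Ftilde (a + b, a, c, d) = (a, b, c + d, c) := by
  have h' : a + b ≤ 2 * a := by omega
  simp [Ftilde, h']

theorem Ftilde_add_right {a b c d : ℕ} (h : b < a) :
    Ftilde (a + b, b, c, d) = (a, b, c, c + d) := by
  have h' : ¬ a + b ≤ 2 * b := by omega
  simp [Ftilde, h']

/-- Every pair of coprime parts with positive coprime multiplicities is reached from a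
quadruple `(n, r, 1, 0)`. -/
theorem exists_Ftilde_iterate_eq {a b c d : ℕ} (hb : 0 < b) (hba : b < a) (hc : 0 < c)
    (hd : 0 < d) (hab : Nat.Coprime a b) (hcd : Nat.Coprime c d) :
    ∃ r m : ℕ, 1 ≤ r ∧ r < c * a + d * b ∧ Nat.gcd r (c * a + d * b) = 1 ∧ 1 ≤ m ∧
      Ftilde^[m] (c * a + d * b, r, 1, 0) = (a, b, c, d) := by
  induction hN : c + d using Nat.strong_induction_on generalizing a b c d with
  | _ N ih =>
    rcases lt_trichotomy c d with h | rfl | h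
    · obtain ⟨e, rfl⟩ := Nat.exists_eq_add_of_le h.le
      obtain ⟨r, m, h1, h2, h3, -, h5⟩ := ih (c + e) (by omega) (a := a + b) (b := b) (c := c)
        (d := e) hb (by omega) hc (by omega) (by simpa using hab) (by simpa using hcd) rfl
      have hw : c * (a + b) + e * b = c * a + (c + e) * b := by ring
      rw [hw] at h2 h3 h5
      refine ⟨r, m + 1, h1, h2, h3, by omega, ?_⟩
      rw [Function.iterate_succ_apply', h5, Ftilde_add_right hba]
    · obtain rfl : c = 1 := by simpa using hcd
      refine ⟨a, 1, by omega, by omega, by simpa using hab, le_rfl, ?_⟩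
      simpa using Ftilde_add_left (c := 1) (d := 0) hba.le
    · obtain ⟨e, rfl⟩ := Nat.exists_eq_add_of_le h.le
      obtain ⟨r, m, h1, h2, h3, -, h5⟩ := ih (d + e) (by omega) (a := a + b) (b := a) (c := d)
        (d := e) (by omega) (by omega) hd (by omega)
        (by simpa [Nat.coprime_comm] using hab) (by simpa [Nat.coprime_comm] using hcd) rfl
      have hw : d * (a + b) + e * a = (d + e) * a + d * b := by ring
      rw [hw] at h2 h3 h5
      refine ⟨r, m + 1, h1, h2, h3, by omega, ?_⟩
      rw [Function.iterate_succ_apply', h5, Ftilde_add_left hba.le]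

/-- A partition `(n₁^{k₁}, n₂^{k₂}) ⊢ n` into two distinct parts arises from the dynamics
of the Farey map (i.e. from iterating `F̃` starting at `(n, r, 1, 0)` for some `r` coprime
to `n`) if and only if `gcd(n₁, n₂) = 1` and `gcd(k₁, k₂) = 1`. -/
theorem twoParts_farey_characterization (n n₁ n₂ k₁ k₂ : ℕ) (hn : 2 ≤ n)
    (hn₁ : 0 < n₁) (hn₂ : 0 < n₂) (hk₁ : 0 < k₁) (hk₂ : 0 < k₂)
    (hlt : n₂ < n₁) (hsum : k₁ * n₁ + k₂ * n₂ = n) :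
    (∃ r m : ℕ, 1 ≤ r ∧ r < n ∧ Nat.gcd r n = 1 ∧ 1 ≤ m ∧
        Ftilde^[m] (n, r, 1, 0) = (n₁, n₂, k₁, k₂)) ↔
      Nat.gcd n₁ n₂ = 1 ∧ Nat.gcd k₁ k₂ = 1 := by
  constructor
  · rintro ⟨r, m, -, hr, hg, -, h⟩
    have := Ftilde_iterate_coprime (q := (n, r, 1, 0)) hr.le (Nat.coprime_comm.mp hg)
      (Nat.coprime_one_left 0) m
    rw [h] at this
    exact this.2
  · rintro ⟨hp, hk⟩
    subst hsum
    exact exists_Ftilde_iterate_eq hn₂ hlt hk₁ hk₂ hp hk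
end

section
/- For every integer n ≥ 2, 2·p_F(2, n) = (Σ over r with 1 ≤ r ≤ n − 1 and gcd(r, n) = 1 of dep(r/n)) − φ(n), where φ is Euler's totient function. -/
/-- The slow Farey step `S(a, b) = (min(a, b − a), max(a, b − a))`. -/
def fareyStep : ℕ × ℕ → ℕ × ℕ := fun p => (min p.1 (p.2 - p.1), max p.1 (p.2 - p.1))

/-- The depth `dep(r/n)`: the least `k ≥ 1` such that the two coordinates of
`S^k(r, n)` are equal (the level of the Farey tree on which `r/n` appears). -/
noncomputable def dep (r n : ℕ) : ℕ :=
  sInf {k : ℕ | 1 ≤ k ∧ (fareyStep^[k] (r, n)).1 = (fareyStep^[k] (r, n)).2}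

/-- `(n₁, n₂, k₁, k₂)` represents a partition of `n` into two distinct part sizes
with multiplicities: `n₁ > n₂ ≥ 1`, `k₁, k₂ ≥ 1` and `k₁·n₁ + k₂·n₂ = n`. -/
def IsTwoPart (n : ℕ) (q : ℕ × ℕ × ℕ × ℕ) : Prop :=
  0 < q.2.1 ∧ q.2.1 < q.1 ∧ 0 < q.2.2.1 ∧ 0 < q.2.2.2 ∧
    q.2.2.1 * q.1 + q.2.2.2 * q.2.1 = n

/-- `p(2, n)`, the number of partitions of `n` into two distinct part sizes. -/
noncomputable def p2 (n : ℕ) : ℕ := {q : ℕ × ℕ × ℕ × ℕ | IsTwoPart n q}.ncard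

/-- `p_F(2, n)`, the number of partitions of `n` into two distinct part sizes with
coprime parts and coprime multiplicities (those obtainable from the Farey map). -/
noncomputable def pF2 (n : ℕ) : ℕ :=
  {q : ℕ × ℕ × ℕ × ℕ | IsTwoPart n q ∧
    Nat.gcd q.1 q.2.1 = 1 ∧ Nat.gcd q.2.2.1 q.2.2.2 = 1}.ncard

theorem fareyStep_mk (r n : ℕ) : fareyStep (r, n) = (min r (n - r), max r (n - r)) := rfl

theorem exists_fareyStep_iterate_eq (n : ℕ) : ∀ r : ℕ, 0 < r → r < n →
    ∃ k : ℕ, 1 ≤ k ∧ (fareyStep^[k] (r, n)).1 = (fareyStep^[k] (r, n)).2 := by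
  induction n using Nat.strong_induction_on with
  | _ n ih =>
    intro r hr hrn
    by_cases h : r = n - r
    · refine ⟨1, le_rfl, ?_⟩
      rw [Function.iterate_one, fareyStep_mk, ← h]
      simp
    · obtain ⟨k, -, hk⟩ := ih (max r (n - r)) (by omega) (min r (n - r)) (by omega) (by omega)
      refine ⟨k + 1, by omega, ?_⟩
      rwa [Function.iterate_succ_apply, fareyStep_mk]

theorem dep_sub (r n : ℕ) (h : r ≤ n) : dep (n - r) n = dep r n := by
  have hS : fareyStep (n - r, n) = fareyStep (r, n) := by
    rw [fareyStep_mk, fareyStep_mk, Nat.sub_sub_self h, min_comm, max_comm]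
  unfold dep
  congr 1
  ext k
  cases k with
  | zero => simp
  | succ k => simp only [Set.mem_ofPred_eq, Function.iterate_succ_apply, hS]

theorem dep_self_add_self (a : ℕ) : dep a (a + a) = 1 := by
  unfold dep
  apply le_antisymm
  · apply Nat.sInf_le
    simp [fareyStep_mk]
  · refine (Nat.sInf_mem (s := {k : ℕ | 1 ≤ k ∧ _}) ⟨1, le_rfl, ?_⟩).1
    simp [fareyStep_mk]

theorem dep_add_of_lt {a b : ℕ} (ha : 0 < a) (hab : a < b) : dep a (a + b) = dep a b + 1 := by
  have hS : fareyStep (a, a + b) = (a, b) := by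
    rw [fareyStep_mk, Nat.add_sub_cancel_left, min_eq_left hab.le, max_eq_right hab.le]
  have h₁ := Nat.sInf_mem (exists_fareyStep_iterate_eq (a + b) a ha (by omega))
  have h₂ := Nat.sInf_mem (exists_fareyStep_iterate_eq b a ha hab)
  change 1 ≤ dep a (a + b) ∧ (fareyStep^[dep a (a + b)] (a, a + b)).1 =
    (fareyStep^[dep a (a + b)] (a, a + b)).2 at h₁
  change 1 ≤ dep a b ∧ (fareyStep^[dep a b] (a, b)).1 = (fareyStep^[dep a b] (a, b)).2 at h₂
  apply le_antisymm
  · refine Nat.sInf_le ⟨by omega, ?_⟩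
    rw [Function.iterate_succ_apply, hS]
    exact h₂.2
  · obtain ⟨m, hm⟩ : ∃ m, dep a (a + b) = m + 1 := ⟨dep a (a + b) - 1, by omega⟩
    rw [hm, Function.iterate_succ_apply, hS] at h₁
    rw [hm]
    refine Nat.succ_le_succ (Nat.sInf_le ⟨?_, h₁.2⟩)
    by_contra h0
    have : m = 0 := by omega
    subst this
    exact hab.ne h₁.2

theorem dep_add_comm (a b : ℕ) : dep a (a + b) = dep b (b + a) := by
  have := dep_sub a (a + b) (by omega)
  rw [Nat.add_sub_cancel_left] at this
  rw [← this, add_comm]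

/-- The quadruples `(a, b, k, l)` of positive integers with `k * a + l * b = n`,
`gcd(a, b) = 1` and `gcd(k, l) = 1`. -/
def coprimeQuadruples (n : ℕ) : Finset (ℕ × ℕ × ℕ × ℕ) :=
  (Finset.range (n + 1) ×ˢ Finset.range (n + 1) ×ˢ Finset.range (n + 1) ×ˢ
    Finset.range (n + 1)).filter fun q =>
      0 < q.1 ∧ 0 < q.2.1 ∧ 0 < q.2.2.1 ∧ 0 < q.2.2.2 ∧
        q.2.2.1 * q.1 + q.2.2.2 * q.2.1 = n ∧ Nat.Coprime q.1 q.2.1 ∧ Nat.Coprime q.2.2.1 q.2.2.2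

theorem mem_coprimeQuadruples {n a b k l : ℕ} : (a, b, k, l) ∈ coprimeQuadruples n ↔
    0 < a ∧ 0 < b ∧ 0 < k ∧ 0 < l ∧ k * a + l * b = n ∧ Nat.Coprime a b ∧ Nat.Coprime k l := by
  simp only [coprimeQuadruples, Finset.mem_filter, Finset.mem_product, Finset.mem_range,
    and_iff_right_iff_imp]
  rintro ⟨ha, hb, hk, hl, h, -, -⟩
  refine ⟨?_, ?_, ?_, ?_⟩ <;> nlinarith

/-- One step of the subtractive Euclidean algorithm on `(a, b)`, compensated on `(k, l)` so that
`k * a + l * b` does not change. -/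
def euclidStep (q : ℕ × ℕ × ℕ × ℕ) : ℕ × ℕ × ℕ × ℕ :=
  if q.1 < q.2.1 then (q.1, q.2.1 - q.1, q.2.2.1 + q.2.2.2, q.2.2.2)
  else (q.1 - q.2.1, q.2.1, q.2.2.1, q.2.2.1 + q.2.2.2)

/-- The inverse of `euclidStep`. -/
def euclidStepInv (q : ℕ × ℕ × ℕ × ℕ) : ℕ × ℕ × ℕ × ℕ :=
  if q.2.2.2 < q.2.2.1 then (q.1, q.1 + q.2.1, q.2.2.1 - q.2.2.2, q.2.2.2)
  else (q.1 + q.2.1, q.2.1, q.2.2.1, q.2.2.2 - q.2.2.1)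

theorem euclidStep_mem {n : ℕ} {q : ℕ × ℕ × ℕ × ℕ} (hq : q ∈ coprimeQuadruples n)
    (hne : q.1 ≠ q.2.1) : euclidStep q ∈ coprimeQuadruples n ∧
      (euclidStep q).2.2.1 ≠ (euclidStep q).2.2.2 ∧ euclidStepInv (euclidStep q) = q ∧
      dep q.1 (q.1 + q.2.1) =
        dep (euclidStep q).1 ((euclidStep q).1 + (euclidStep q).2.1) + 1 := by
  obtain ⟨a, b, k, l⟩ := q
  rw [mem_coprimeQuadruples] at hq
  obtain ⟨ha, hb, hk, hl, h, hab, hkl⟩ := hq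
  simp only at hne
  rcases lt_or_gt_of_ne hne with hlt | hlt
  · obtain ⟨c, rfl⟩ := Nat.exists_eq_add_of_lt hlt
    have hS : euclidStep (a, a + c + 1, k, l) = (a, c + 1, k + l, l) := by
      simp only [euclidStep, if_pos hlt, Prod.mk.injEq, and_true, true_and]
      omega
    rw [hS]
    refine ⟨mem_coprimeQuadruples.2 ⟨ha, by omega, by omega, hl, by rw [← h]; ring, ?_, ?_⟩,
      by simp only; omega, ?_, ?_⟩
    · rw [add_assoc] at hab
      simpa using hab
    · simpa using hkl
    · simp [euclidStepInv, hk, add_assoc]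
    · exact dep_add_of_lt ha hlt
  · obtain ⟨c, rfl⟩ := Nat.exists_eq_add_of_lt hlt
    have hS : euclidStep (b + c + 1, b, k, l) = (c + 1, b, k, k + l) := by
      simp only [euclidStep, if_neg (not_lt.2 hlt.le), Prod.mk.injEq, and_true]
      omega
    rw [hS]
    refine ⟨mem_coprimeQuadruples.2 ⟨by omega, hb, hk, by omega, by rw [← h]; ring, ?_, ?_⟩,
      by simp only; omega, ?_, ?_⟩
    · rw [add_assoc] at hab
      simpa using hab
    · simpa using hkl
    · simp [euclidStepInv]; omega
    · simp only
      rw [dep_add_comm, dep_add_of_lt hb hlt, dep_add_comm (c + 1) b, add_assoc]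

theorem euclidStepInv_mem {n : ℕ} {q : ℕ × ℕ × ℕ × ℕ} (hq : q ∈ coprimeQuadruples n)
    (hne : q.2.2.1 ≠ q.2.2.2) : euclidStepInv q ∈ coprimeQuadruples n ∧
      (euclidStepInv q).1 ≠ (euclidStepInv q).2.1 ∧ euclidStep (euclidStepInv q) = q := by
  obtain ⟨a, b, k, l⟩ := q
  rw [mem_coprimeQuadruples] at hq
  obtain ⟨ha, hb, hk, hl, h, hab, hkl⟩ := hq
  simp only at hne
  rcases lt_or_gt_of_ne hne with hlt | hlt
  · obtain ⟨c, rfl⟩ := Nat.exists_eq_add_of_lt hlt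
    have hS : euclidStepInv (a, b, k, k + c + 1) = (a + b, b, k, c + 1) := by
      simp only [euclidStepInv, if_neg (not_lt.2 hlt.le), Prod.mk.injEq, true_and]
      omega
    rw [hS]
    refine ⟨mem_coprimeQuadruples.2 ⟨by omega, hb, hk, by omega, by rw [← h]; ring, ?_, ?_⟩,
      by simp only; omega, ?_⟩
    · simpa using hab
    · rw [add_assoc] at hkl
      simpa using hkl
    · simp [euclidStep, add_assoc]
  · obtain ⟨c, rfl⟩ := Nat.exists_eq_add_of_lt hlt
    have hS : euclidStepInv (a, b, l + c + 1, l) = (a, a + b, c + 1, l) := by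
      simp only [euclidStepInv, if_pos hlt, Prod.mk.injEq, and_true, true_and]
      omega
    rw [hS]
    refine ⟨mem_coprimeQuadruples.2 ⟨ha, by omega, by omega, hl, by rw [← h]; ring, ?_, ?_⟩,
      by simp only; omega, ?_⟩
    · simpa using hab
    · rw [add_assoc] at hkl
      simpa using hkl
    · simp [euclidStep, hb]; omega

theorem card_coprimeQuadruples (n : ℕ) : (coprimeQuadruples n).card =
    ∑ q ∈ coprimeQuadruples n with q.2.2.1 = q.2.2.2, dep q.1 (q.1 + q.2.1) := by
  have hbij : ∑ q ∈ coprimeQuadruples n with ¬ q.1 = q.2.1, dep q.1 (q.1 + q.2.1) =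
      (∑ q ∈ coprimeQuadruples n with ¬ q.2.2.1 = q.2.2.2, (dep q.1 (q.1 + q.2.1) + 1)) := by
    refine Finset.sum_bij' (fun q _ => euclidStep q) (fun q _ => euclidStepInv q) ?_ ?_ ?_ ?_ ?_ <;>
      simp only [Finset.mem_filter] <;> rintro q ⟨hq, hne⟩
    · exact ⟨(euclidStep_mem hq hne).1, (euclidStep_mem hq hne).2.1⟩
    · exact ⟨(euclidStepInv_mem hq hne).1, (euclidStepInv_mem hq hne).2.1⟩
    · exact (euclidStep_mem hq hne).2.2.1
    · exact (euclidStepInv_mem hq hne).2.2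
    · exact (euclidStep_mem hq hne).2.2.2
  have hcard : (coprimeQuadruples n |>.filter fun q => ¬ q.1 = q.2.1).card =
      (coprimeQuadruples n |>.filter fun q => ¬ q.2.2.1 = q.2.2.2).card := by
    refine Finset.card_bij' (fun q _ => euclidStep q) (fun q _ => euclidStepInv q) ?_ ?_ ?_ ?_ <;>
      simp only [Finset.mem_filter] <;> rintro q ⟨hq, hne⟩
    · exact ⟨(euclidStep_mem hq hne).1, (euclidStep_mem hq hne).2.1⟩
    · exact ⟨(euclidStepInv_mem hq hne).1, (euclidStepInv_mem hq hne).2.1⟩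
    · exact (euclidStep_mem hq hne).2.2.1
    · exact (euclidStepInv_mem hq hne).2.2
  have hone : ∑ q ∈ coprimeQuadruples n with q.1 = q.2.1, dep q.1 (q.1 + q.2.1) =
      (coprimeQuadruples n |>.filter fun q => q.1 = q.2.1).card := by
    rw [Finset.card_eq_sum_ones]
    refine Finset.sum_congr rfl fun q hq => ?_
    rw [← (Finset.mem_filter.1 hq).2, dep_self_add_self]
  have h₁ := Finset.sum_filter_add_sum_filter_not (coprimeQuadruples n) (fun q => q.1 = q.2.1)
    (fun q => dep q.1 (q.1 + q.2.1))
  have h₂ := Finset.sum_filter_add_sum_filter_not (coprimeQuadruples n)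
    (fun q => q.2.2.1 = q.2.2.2) (fun q => dep q.1 (q.1 + q.2.1))
  have h₃ := Finset.card_filter_add_card_filter_not (s := coprimeQuadruples n)
    (fun q => q.1 = q.2.1)
  rw [Finset.sum_add_distrib, ← Finset.card_eq_sum_ones] at hbij
  omega

theorem sum_dep_eq_card_coprimeQuadruples {n : ℕ} :
    ∑ r ∈ (Finset.Ico 1 n).filter (fun r => Nat.gcd r n = 1), dep r n =
      (coprimeQuadruples n).card := by
  rw [card_coprimeQuadruples]
  refine Finset.sum_bij' (fun r _ => (r, n - r, 1, 1)) (fun q _ => q.1) ?_ ?_ ?_ ?_ ?_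
  · intro r hr
    simp only [Finset.mem_filter, Finset.mem_Ico] at hr
    obtain ⟨⟨h1, h2⟩, h3⟩ := hr
    refine Finset.mem_filter.2 ⟨mem_coprimeQuadruples.2
      ⟨h1, by omega, one_pos, one_pos, by omega, ?_, Nat.coprime_one_left 1⟩, rfl⟩
    exact (Nat.coprime_sub_self_right h2.le).2 h3
  · rintro ⟨a, b, k, l⟩ hq
    simp only [Finset.mem_filter, mem_coprimeQuadruples] at hq
    obtain ⟨⟨ha, hb, hk, hl, h, hab, hkl⟩, rfl⟩ := hq
    obtain rfl : k = 1 := by simpa using hkl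
    have h' : n = a + b := by omega
    subst h'
    simp only [Finset.mem_filter, Finset.mem_Ico]
    exact ⟨by omega, by simpa using hab⟩
  · intro r hr
    rfl
  · rintro ⟨a, b, k, l⟩ hq
    simp only [Finset.mem_filter, mem_coprimeQuadruples] at hq
    obtain ⟨⟨ha, hb, hk, hl, h, hab, hkl⟩, rfl⟩ := hq
    obtain rfl : k = 1 := by simpa using hkl
    simp only [Prod.mk.injEq, and_true, true_and]
    omega
  · intro r hr
    simp only [Finset.mem_filter, Finset.mem_Ico] at hr
    simp only
    rw [Nat.add_sub_cancel' (by omega)]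

theorem pF2_eq_card (n : ℕ) :
    pF2 n = ((coprimeQuadruples n).filter fun q => q.2.1 < q.1).card := by
  rw [pF2, ← Set.ncard_coe_finset]
  congr 1
  ext ⟨a, b, k, l⟩
  simp only [IsTwoPart, Set.mem_ofPred_eq, Finset.coe_filter, mem_coprimeQuadruples, Nat.Coprime]
  constructor
  · rintro ⟨⟨h1, h2, h3, h4, h5⟩, h6, h7⟩
    exact ⟨⟨by omega, h1, h3, h4, h5, h6, h7⟩, h2⟩
  · rintro ⟨⟨h0, h1, h3, h4, h5, h6, h7⟩, h2⟩
    exact ⟨⟨h1, h2, h3, h4, h5⟩, h6, h7⟩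

theorem card_coprimeQuadruples_filter_lt (n : ℕ) :
    ((coprimeQuadruples n).filter fun q => q.1 < q.2.1).card =
      ((coprimeQuadruples n).filter fun q => q.2.1 < q.1).card := by
  refine Finset.card_bij' (fun q _ => (q.2.1, q.1, q.2.2.2, q.2.2.1))
    (fun q _ => (q.2.1, q.1, q.2.2.2, q.2.2.1)) ?_ ?_ (fun _ _ => rfl) (fun _ _ => rfl) <;>
  · rintro ⟨a, b, k, l⟩ hq
    simp only [Finset.mem_filter, mem_coprimeQuadruples] at hq ⊢
    obtain ⟨⟨ha, hb, hk, hl, h, hab, hkl⟩, hlt⟩ := hq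
    exact ⟨⟨hb, ha, hl, hk, by omega, hab.symm, hkl.symm⟩, hlt⟩

theorem card_coprimeQuadruples_filter_eq {n : ℕ} (hn : 2 ≤ n) :
    ((coprimeQuadruples n).filter fun q => q.1 = q.2.1).card = Nat.totient n := by
  rw [Nat.totient_eq_card_coprime]
  refine Finset.card_bij' (fun q _ => q.2.2.1) (fun r _ => (1, 1, r, n - r)) ?_ ?_ ?_ ?_
  · rintro ⟨a, b, k, l⟩ hq
    simp only [Finset.mem_filter, mem_coprimeQuadruples] at hq
    obtain ⟨⟨ha, hb, hk, hl, h, hab, hkl⟩, rfl⟩ := hq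
    obtain rfl : a = 1 := by simpa using hab
    have h' : n = k + l := by omega
    subst h'
    simp only [Finset.mem_filter, Finset.mem_range]
    exact ⟨by omega, by simpa using hkl.symm⟩
  · intro r hr
    simp only [Finset.mem_filter, Finset.mem_range] at hr
    obtain ⟨hrn, hr⟩ := hr
    have hr0 : 0 < r := by
      rcases Nat.eq_zero_or_pos r with rfl | h
      · rw [Nat.coprime_zero_right] at hr
        omega
      · exact h
    exact Finset.mem_filter.2 ⟨mem_coprimeQuadruples.2 ⟨one_pos, one_pos, hr0, by omega, by omega,
      Nat.coprime_one_left 1, (Nat.coprime_sub_self_right hrn.le).2 hr.symm⟩, rfl⟩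
  · rintro ⟨a, b, k, l⟩ hq
    simp only [Finset.mem_filter, mem_coprimeQuadruples] at hq
    obtain ⟨⟨ha, hb, hk, hl, h, hab, hkl⟩, rfl⟩ := hq
    obtain rfl : a = 1 := by simpa using hab
    simp only [Prod.mk.injEq, true_and]
    omega
  · intro r hr
    rfl

theorem card_coprimeQuadruples_eq {n : ℕ} (hn : 2 ≤ n) :
    (coprimeQuadruples n).card = 2 * pF2 n + Nat.totient n := by
  have h₁ := Finset.card_filter_add_card_filter_not (s := coprimeQuadruples n)
    (fun q => q.1 = q.2.1)
  have h₂ := Finset.card_filter_add_card_filter_not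
    (s := (coprimeQuadruples n).filter fun q => ¬ q.1 = q.2.1) (fun q => q.1 < q.2.1)
  rw [Finset.filter_filter, Finset.filter_filter,
    Finset.filter_congr (q := fun q => q.1 < q.2.1) (fun q _ => by omega),
    Finset.filter_congr (p := fun q : ℕ × ℕ × ℕ × ℕ => ¬ q.1 = q.2.1 ∧ ¬ q.1 < q.2.1)
      (q := fun q => q.2.1 < q.1) (fun q _ => by omega),
    card_coprimeQuadruples_filter_lt] at h₂
  have h₃ := card_coprimeQuadruples_filter_eq hn
  rw [pF2_eq_card]
  omega

/-- For every `n ≥ 2`,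
`2·p_F(2, n) = (Σ_{1 ≤ r ≤ n−1, gcd(r,n)=1} dep(r/n)) − φ(n)`. -/
theorem pF2_formula (n : ℕ) (hn : 2 ≤ n) :
    (2 * pF2 n : ℤ) =
      (∑ r ∈ (Finset.Ico 1 n).filter (fun r => Nat.gcd r n = 1), (dep r n : ℤ)) -
        Nat.totient n := by
  rw [← Nat.cast_sum, sum_dep_eq_card_coprimeQuadruples, card_coprimeQuadruples_eq hn]
  push_cast
  ring
end

section
/- For every integer n ≥ 2, p_F(2, n) = p(2, n) if and only if n is prime or n = 4. -/
theorem setOf_isTwoPart_finite (n : ℕ) : {q : ℕ × ℕ × ℕ × ℕ | IsTwoPart n q}.Finite := by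
  refine (Set.finite_Iic ((n, n, n, n) : ℕ × ℕ × ℕ × ℕ)).subset ?_
  rintro ⟨a, b, k, l⟩ ⟨hb, hab, hk, hl, h⟩
  dsimp only at hb hab hk hl h
  have h₁ : a ≤ n := by nlinarith
  have h₂ : k ≤ n := by nlinarith
  have h₃ : l ≤ n := by nlinarith
  exact ⟨h₁, (hab.le.trans h₁ : b ≤ n), h₂, h₃⟩

theorem pF2_eq_p2_iff_forall_coprime (n : ℕ) :
    pF2 n = p2 n ↔ ∀ q : ℕ × ℕ × ℕ × ℕ, IsTwoPart n q →
      Nat.gcd q.1 q.2.1 = 1 ∧ Nat.gcd q.2.2.1 q.2.2.2 = 1 := by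
  constructor
  · intro h q hq
    have hsets := Set.eq_of_subset_of_ncard_le
      (s := {q : ℕ × ℕ × ℕ × ℕ | IsTwoPart n q ∧
        Nat.gcd q.1 q.2.1 = 1 ∧ Nat.gcd q.2.2.1 q.2.2.2 = 1})
      (t := {q | IsTwoPart n q}) (fun _ hx => hx.1) h.ge (setOf_isTwoPart_finite n)
    exact (hsets.ge hq).2
  · intro h
    exact congrArg Set.ncard (Set.ext fun q => ⟨fun hq => hq.1, fun hq => ⟨hq, h q hq⟩⟩)

theorem IsTwoPart.coprime_of_prime {p : ℕ} (hp : p.Prime) {q : ℕ × ℕ × ℕ × ℕ}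
    (hq : IsTwoPart p q) : Nat.gcd q.1 q.2.1 = 1 ∧ Nat.gcd q.2.2.1 q.2.2.2 = 1 := by
  obtain ⟨a, b, k, l⟩ := q
  obtain ⟨hb, hab, hk, hl, h⟩ := hq
  dsimp only at *
  constructor
  · have hdvd : Nat.gcd a b ∣ p := h ▸ dvd_add
      ((Nat.gcd_dvd_left a b).mul_left k) ((Nat.gcd_dvd_right a b).mul_left l)
    refine (hp.eq_one_or_self_of_dvd _ hdvd).resolve_right fun hg => ?_
    have := Nat.gcd_le_right a hb
    nlinarith
  · have hdvd : Nat.gcd k l ∣ p := h ▸ dvd_add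
      ((Nat.gcd_dvd_left k l).mul_right a) ((Nat.gcd_dvd_right k l).mul_right b)
    refine (hp.eq_one_or_self_of_dvd _ hdvd).resolve_right fun hg => ?_
    have := Nat.gcd_le_left l hk
    nlinarith

theorem IsTwoPart.coprime_of_four {q : ℕ × ℕ × ℕ × ℕ} (hq : IsTwoPart 4 q) :
    Nat.gcd q.1 q.2.1 = 1 ∧ Nat.gcd q.2.2.1 q.2.2.2 = 1 := by
  obtain ⟨a, b, k, l⟩ := q
  obtain ⟨hb, hab, hk, hl, h⟩ := hq
  dsimp only at *
  have hk₁ : k = 1 := by nlinarith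
  subst hk₁
  have hb₁ : b = 1 := by nlinarith
  subst hb₁
  simp

theorem exists_isTwoPart_not_coprime {n : ℕ} (hn : 2 ≤ n) (hp : ¬ n.Prime) (h4 : n ≠ 4) :
    ∃ q : ℕ × ℕ × ℕ × ℕ, IsTwoPart n q ∧ Nat.gcd q.1 q.2.1 ≠ 1 := by
  obtain ⟨b, hb⟩ := n.minFac_dvd
  have ha := (Nat.minFac_prime (by lia : n ≠ 1)).two_le
  have hsq := Nat.minFac_sq_le_self (by lia) hp
  generalize n.minFac = a at hb ha hsq
  have hab : a ≤ b := by nlinarith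
  have hb3 : 3 ≤ b := by
    by_contra! hlt
    obtain rfl : a = 2 := by lia
    obtain rfl : b = 2 := by lia
    exact h4 hb
  obtain ⟨c, rfl⟩ := Nat.exists_eq_add_of_le' hb3
  refine ⟨(2 * a, a, 1, c + 1), ⟨?_, ?_, one_pos, c.succ_pos, ?_⟩, ?_⟩
  · dsimp only
    lia
  · dsimp only
    lia
  · dsimp only
    rw [hb]
    ring
  · rw [Nat.gcd_mul_left_left]
    lia

/-- For every `n ≥ 2`, `p_F(2, n) = p(2, n)` if and only if `n` is prime or `n = 4`. -/
theorem pF2_eq_p2_iff (n : ℕ) (hn : 2 ≤ n) :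
    pF2 n = p2 n ↔ Nat.Prime n ∨ n = 4 := by
  rw [pF2_eq_p2_iff_forall_coprime]
  constructor
  · intro h
    by_contra! hne
    obtain ⟨q, hq, hgcd⟩ := exists_isTwoPart_not_coprime hn hne.1 hne.2
    exact hgcd (h q hq).1
  · rintro (hp | rfl) q hq
    · exact hq.coprime_of_prime hp
    · exact hq.coprime_of_four
end

section
/- For every finite word σ₁σ₂⋯σ_ℓ with each σ_j ∈ {0, 1} and every quadruple (n₁, n₂, k₁, k₂) ∈ ℤ⁴: if F̃_{σ_ℓ} ∘ ⋯ ∘ F̃_{σ₁}(n₁, n₂, k₁, k₂) = (n̄₁, n̄₂, k̄₁, k̄₂), then applying the maps in reversed order to the conjugate of the result recovers the conjugate of the start, i.e. F̃_{σ₁} ∘ ⋯ ∘ F̃_{σ_ℓ}(k̄₁ + k̄₂, k̄₁, n̄₂, n̄₁ − n̄₂) = (k₁ + k₂, k₁, n₂, n₁ − n₂). -/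
/-- The branch `F̃₀` of the extended Farey map on `ℤ⁴`:
`F̃₀(n₁, n₂, k₁, k₂) = (n₂, n₁ − n₂, k₁ + k₂, k₁)`. -/
def F0 : ℤ × ℤ × ℤ × ℤ → ℤ × ℤ × ℤ × ℤ := fun q =>
  (q.2.1, q.1 - q.2.1, q.2.2.1 + q.2.2.2, q.2.2.1)

/-- The branch `F̃₁` of the extended Farey map on `ℤ⁴`:
`F̃₁(n₁, n₂, k₁, k₂) = (n₁ − n₂, n₂, k₁, k₁ + k₂)`. -/
def F1 : ℤ × ℤ × ℤ × ℤ → ℤ × ℤ × ℤ × ℤ := fun q =>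
  (q.1 - q.2.1, q.2.1, q.2.2.1, q.2.2.1 + q.2.2.2)

/-- Conjugation of partitions (flipping the Young shape):
`C(n₁, n₂, k₁, k₂) = (k₁ + k₂, k₁, n₂, n₁ − n₂)`. -/
def Cconj : ℤ × ℤ × ℤ × ℤ → ℤ × ℤ × ℤ × ℤ := fun q =>
  (q.2.2.1 + q.2.2.2, q.2.2.1, q.2.1, q.1 - q.2.1)

/-- The branch of the extended Farey map indexed by a binary digit. -/
def Fb (b : Bool) : ℤ × ℤ × ℤ × ℤ → ℤ × ℤ × ℤ × ℤ := if b then F1 else F0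

/-- `applyWord [σ₁, …, σ_ℓ] q = F̃_{σ_ℓ} ∘ ⋯ ∘ F̃_{σ₁} (q)`. -/
def applyWord (σ : List Bool) (q : ℤ × ℤ × ℤ × ℤ) : ℤ × ℤ × ℤ × ℤ :=
  σ.foldl (fun x b => Fb b x) q

/-- Each branch, conjugated by `Cconj`, is its own inverse. -/
theorem Fb_Cconj_Fb (b : Bool) (q : ℤ × ℤ × ℤ × ℤ) : Fb b (Cconj (Fb b q)) = Cconj q := by
  cases b <;> simp [Fb, F0, F1, Cconj]

theorem applyWord_reverse_Cconj (σ : List Bool) (q : ℤ × ℤ × ℤ × ℤ) :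
    applyWord σ.reverse (Cconj (applyWord σ q)) = Cconj q := by
  induction σ generalizing q with
  | nil => rfl
  | cons b σ ih =>
    have h := ih (Fb b q)
    simp only [applyWord] at h
    simp only [applyWord, List.reverse_cons, List.foldl_append, List.foldl_cons, List.foldl_nil, h,
      Fb_Cconj_Fb]

/-- Palindrome theorem: if `F̃_{σ_ℓ} ∘ ⋯ ∘ F̃_{σ₁}(n₁, n₂, k₁, k₂) = (n̄₁, n̄₂, k̄₁, k̄₂)`,
then applying the maps in reversed order to the conjugate of the result recovers the
conjugate of the start. -/
theorem palindrome_conjugation (σ : List Bool) (n₁ n₂ k₁ k₂ nb₁ nb₂ kb₁ kb₂ : ℤ)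
    (h : applyWord σ (n₁, n₂, k₁, k₂) = (nb₁, nb₂, kb₁, kb₂)) :
    applyWord σ.reverse (kb₁ + kb₂, kb₁, nb₂, nb₁ - nb₂) = (k₁ + k₂, k₁, n₂, n₁ - n₂) := by
  simpa only [h, Cconj] using applyWord_reverse_Cconj σ (n₁, n₂, k₁, k₂)
end

section
/- Let n ≥ 2, 1 ≤ r < n, and let d ≥ 1, e ≥ 1 and m ≥ 0 be integers. Then the m-th iterate of F̃ applied to (n, r, 1, 0) equals (n₁, n₂, k₁, k₂) if and only if the m-th iterate of F̃ applied to (d·n, d·r, e, 0) equals (d·n₁, d·n₂, e·k₁, e·k₂). -/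
/-- Scaling the parts by `d` and the multiplicities by `e`. -/
def scaleQuadruple (d e : ℕ) (q : ℕ × ℕ × ℕ × ℕ) : ℕ × ℕ × ℕ × ℕ :=
  (d * q.1, d * q.2.1, e * q.2.2.1, e * q.2.2.2)

theorem scaleQuadruple_injective {d e : ℕ} (hd : 0 < d) (he : 0 < e) :
    Function.Injective (scaleQuadruple d e) := by
  rintro ⟨a, b, c, f⟩ ⟨a', b', c', f'⟩ h
  simpa [scaleQuadruple, hd.ne', he.ne'] using h

theorem semiconj_scaleQuadruple_Ftilde {d : ℕ} (e : ℕ) (hd : 0 < d) :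
    Function.Semiconj (scaleQuadruple d e) Ftilde Ftilde := by
  rintro ⟨a, b, c, f⟩
  have h : d * a ≤ 2 * (d * b) ↔ a ≤ 2 * b := by
    rw [mul_left_comm, Nat.mul_le_mul_left_iff hd]
  by_cases hab : a ≤ 2 * b <;> simp [scaleQuadruple, Ftilde, h, hab, Nat.mul_sub, mul_add]

/-- Scaling lemma: the `m`-th iterate of `F̃` on `(n, r, 1, 0)` equals `(n₁, n₂, k₁, k₂)`
iff the `m`-th iterate on `(d·n, d·r, e, 0)` equals `(d·n₁, d·n₂, e·k₁, e·k₂)`. -/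
theorem extendedFarey_scaling (n r d e m n₁ n₂ k₁ k₂ : ℕ) (hn : 2 ≤ n)
    (hr1 : 1 ≤ r) (hrn : r < n) (hd : 1 ≤ d) (he : 1 ≤ e) :
    Ftilde^[m] (n, r, 1, 0) = (n₁, n₂, k₁, k₂) ↔
      Ftilde^[m] (d * n, d * r, e, 0) = (d * n₁, d * n₂, e * k₁, e * k₂) := by
  have h := (semiconj_scaleQuadruple_Ftilde e hd).iterate_right m (n, r, 1, 0)
  rw [← (scaleQuadruple_injective hd he).eq_iff, h]
  simp only [scaleQuadruple, mul_one, mul_zero]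
end

section
/- Let (n₁, n₂, k₁, k₂) be positive integers with n₁ > n₂, gcd(n₁, n₂) = 1 and gcd(k₁, k₂) = 1, and set n = k₁·n₁ + k₂·n₂. Then there exist an integer r with 1 ≤ r < n and gcd(r, n) = 1 and an integer m ≥ 1 such that the m-th iterate of F̃ applied to (n, r, 1, 0) equals (n₁, n₂, k₁, k₂); that is, (n, r) × [1, 0] is an ancestor of (n₁, n₂) × [k₁, k₂] under the extended Farey map. -/
theorem Ftilde_swap_branch {n₁ n₂ k₁ k₂ : ℕ} (hn : n₂ ≤ n₁) (hk : k₂ ≤ k₁) :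
    Ftilde (n₁ + n₂, n₁, k₂, k₁ - k₂) = (n₁, n₂, k₁, k₂) := by
  simp only [Ftilde]
  rw [if_pos (by omega), Nat.add_sub_cancel_left, Nat.add_sub_cancel' hk]

theorem Ftilde_subtract_branch {n₁ n₂ k₁ k₂ : ℕ} (hn : n₂ < n₁) (hk : k₁ ≤ k₂) :
    Ftilde (n₁ + n₂, n₂, k₁, k₂ - k₁) = (n₁, n₂, k₁, k₂) := by
  simp only [Ftilde]
  rw [if_neg (by omega), Nat.add_sub_cancel, Nat.add_sub_cancel' hk]

/-- If `(n₁, n₂, k₁, k₂)` are positive with `n₁ > n₂`, `gcd(n₁, n₂) = 1`, `gcd(k₁, k₂) = 1`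
and `n = k₁·n₁ + k₂·n₂`, then there is `r` with `1 ≤ r < n`, `gcd(r, n) = 1` such that
`(n, r) × [1, 0]` is an ancestor of `(n₁, n₂) × [k₁, k₂]` under the extended Farey map. -/
theorem twoParts_has_ancestor (n₁ n₂ k₁ k₂ : ℕ)
    (hn₁ : 0 < n₁) (hn₂ : 0 < n₂) (hk₁ : 0 < k₁) (hk₂ : 0 < k₂) (hlt : n₂ < n₁)
    (hcop₁ : Nat.gcd n₁ n₂ = 1) (hcop₂ : Nat.gcd k₁ k₂ = 1) :
    ∃ r m : ℕ, 1 ≤ r ∧ r < k₁ * n₁ + k₂ * n₂ ∧ Nat.gcd r (k₁ * n₁ + k₂ * n₂) = 1 ∧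
      1 ≤ m ∧ Ftilde^[m] (k₁ * n₁ + k₂ * n₂, r, 1, 0) = (n₁, n₂, k₁, k₂) := by
  induction hs : k₁ + k₂ using Nat.strong_induction_on generalizing n₁ n₂ k₁ k₂ with
  | _ s ih =>
  rcases lt_trichotomy k₁ k₂ with hk | hk | hk
  · obtain ⟨r, m, hr, hrn, hgcd, -, hiter⟩ := ih _ (by omega) (n₁ + n₂) n₂ k₁ (k₂ - k₁)
      (by omega) hn₂ hk₁ (by omega) (by omega) (by simpa using hcop₁)
      (by rwa [Nat.gcd_sub_self_right hk.le]) rfl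
    have hn : k₁ * (n₁ + n₂) + (k₂ - k₁) * n₂ = k₁ * n₁ + k₂ * n₂ := by
      obtain ⟨d, rfl⟩ := Nat.exists_eq_add_of_le hk.le
      rw [Nat.add_sub_cancel_left]
      ring
    rw [hn] at hrn hgcd hiter
    refine ⟨r, m + 1, hr, hrn, hgcd, by omega, ?_⟩
    rw [Function.iterate_succ_apply', hiter, Ftilde_subtract_branch hlt hk.le]
  · obtain rfl : k₁ = 1 := by simpa [← hk] using hcop₂
    subst hk
    refine ⟨n₂, 1, hn₂, by omega, by simpa [Nat.gcd_comm] using hcop₁, le_rfl, ?_⟩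
    simpa using Ftilde_subtract_branch (k₁ := 1) (k₂ := 1) hlt le_rfl
  · obtain ⟨r, m, hr, hrn, hgcd, -, hiter⟩ := ih _ (by omega) (n₁ + n₂) n₁ k₂ (k₁ - k₂)
      (by omega) hn₁ hk₂ (by omega) (by omega) (by simpa [Nat.gcd_comm] using hcop₁)
      (by rwa [Nat.gcd_sub_self_right hk.le, Nat.gcd_comm]) rfl
    have hn : k₂ * (n₁ + n₂) + (k₁ - k₂) * n₁ = k₁ * n₁ + k₂ * n₂ := by
      obtain ⟨d, rfl⟩ := Nat.exists_eq_add_of_le hk.le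
      rw [Nat.add_sub_cancel_left]
      ring
    rw [hn] at hrn hgcd hiter
    refine ⟨r, m + 1, hr, hrn, hgcd, by omega, ?_⟩
    rw [Function.iterate_succ_apply', hiter, Ftilde_swap_branch hlt.le hk.le]
end

section
/- Let n ≥ 2 and let (n₁, n₂, k₁, k₂) be positive integers with n₁ > n₂ and k₁·n₁ + k₂·n₂ = n. Then there exist integers r, e, m with 1 ≤ r < n, e ∣ r, e ∣ n and m ≥ 1 such that the m-th iterate of F̃ applied to (n/e, r/e, e, 0) equals (n₁, n₂, k₁, k₂). In particular, every partition of n into two distinct parts can be obtained from the dynamics of the extended Farey map. -/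
theorem Ftilde_of_le {a b c d : ℕ} (hab : b ≤ a) :
    Ftilde (a + b, a, d, c) = (a, b, d + c, d) := by
  have h : a + b ≤ 2 * a := by omega
  simp [Ftilde, h]

theorem Ftilde_of_lt {a b c d : ℕ} (hab : b < a) :
    Ftilde (a + b, b, c, d) = (a, b, c, c + d) := by
  have h : ¬ a + b ≤ 2 * b := by omega
  simp [Ftilde, h]

/-- Running the Euclidean algorithm backwards on the multiplicities, every quadruple is reached
from one whose second multiplicity vanishes. -/
theorem exists_Ftilde_iterate_eq_s9 (n₁ n₂ k₁ k₂ : ℕ) (hn₂ : 0 < n₂) (hk₁ : 0 < k₁)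
    (hlt : n₂ < n₁) :
    ∃ a b e m : ℕ, 0 < b ∧ b < a ∧ 0 < e ∧ e * a = k₁ * n₁ + k₂ * n₂ ∧ (0 < k₂ → 1 ≤ m) ∧
      Ftilde^[m] (a, b, e, 0) = (n₁, n₂, k₁, k₂) := by
  induction hs : k₁ + k₂ using Nat.strong_induction_on generalizing n₁ n₂ k₁ k₂ with
  | _ s ih =>
    rcases Nat.eq_zero_or_pos k₂ with rfl | hk₂
    · exact ⟨n₁, n₂, k₁, 0, hn₂, hlt, hk₁, by simp, by simp, rfl⟩
    rcases le_or_gt k₁ k₂ with h | h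
    · obtain ⟨d, rfl⟩ := Nat.exists_eq_add_of_le h
      obtain ⟨a, b, e, m, hb, hba, he, hsum, -, hm⟩ :=
        ih (k₁ + d) (by omega) (n₁ + n₂) n₂ k₁ d hn₂ hk₁ (by omega) rfl
      refine ⟨a, b, e, m + 1, hb, hba, he, by rw [hsum]; ring, by simp, ?_⟩
      rw [Function.iterate_succ_apply', hm, Ftilde_of_lt hlt]
    · obtain ⟨d, rfl⟩ := Nat.exists_eq_add_of_le h.le
      obtain ⟨a, b, e, m, hb, hba, he, hsum, -, hm⟩ :=
        ih (k₂ + d) (by omega) (n₁ + n₂) n₁ k₂ d (by omega) hk₂ (by omega) rfl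
      refine ⟨a, b, e, m + 1, hb, hba, he, by rw [hsum]; ring, by simp, ?_⟩
      rw [Function.iterate_succ_apply', hm, Ftilde_of_le hlt.le]

/-- Every partition of `n` into two distinct parts can be obtained from the dynamics of the
extended Farey map: there are `r`, `e`, `m` with `1 ≤ r < n`, `e ∣ r`, `e ∣ n`, `m ≥ 1`
such that the `m`-th iterate of `F̃` applied to `(n/e, r/e, e, 0)` equals `(n₁, n₂, k₁, k₂)`. -/
theorem every_twoPart_partition_obtained (n n₁ n₂ k₁ k₂ : ℕ) (hn : 2 ≤ n)
    (hn₁ : 0 < n₁) (hn₂ : 0 < n₂) (hk₁ : 0 < k₁) (hk₂ : 0 < k₂)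
    (hlt : n₂ < n₁) (hsum : k₁ * n₁ + k₂ * n₂ = n) :
    ∃ r e m : ℕ, 1 ≤ r ∧ r < n ∧ e ∣ r ∧ e ∣ n ∧ 1 ≤ m ∧
      Ftilde^[m] (n / e, r / e, e, 0) = (n₁, n₂, k₁, k₂) := by
  obtain ⟨a, b, e, m, hb, hba, he, hea, hm, h⟩ :=
    exists_Ftilde_iterate_eq_s9 n₁ n₂ k₁ k₂ hn₂ hk₁ hlt
  rw [hsum] at hea
  subst hea
  refine ⟨e * b, e, m, Nat.mul_pos he hb, Nat.mul_lt_mul_of_pos_left hba he,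
    dvd_mul_right e b, dvd_mul_right e a, hm hk₂, ?_⟩
  rwa [Nat.mul_div_cancel_left a he, Nat.mul_div_cancel_left b he]
end

section
/- Let m ≥ 2, let n₁ > n₂ > ⋯ > n_m > 0 be integers and k₁, …, k_m ≥ 0 integers with Σ_{i=1}^m k_i·n_i = n. If n₂ + n_m > n₁, then T̃₀((n₁, …, n_m), (k₁, …, k_m)) = ((a₁, …, a_m), (c₁, …, c_m)) satisfies a₁ > a₂ > ⋯ > a_m > 0 and Σ_{i=1}^m c_i·a_i = n; and if n₂ + n_m < n₁, then the same two conclusions hold for T̃₁((n₁, …, n_m), (k₁, …, k_m)). That is, the extended slow-Triangle map sends a partition of n to a new partition of n. -/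
/-- Parts component of the branch `T̃₀` of the extended slow-Triangle map:
`(n₁, …, n_m) ↦ (n₂, n₃, …, n_m, n₁ − n₂)` (entries are indexed `1, …, m`;
all other indices are left unchanged). -/
def Tpart0 (m : ℕ) (f : ℕ → ℤ) : ℕ → ℤ := fun i =>
  if 1 ≤ i ∧ i < m then f (i + 1) else if i = m then f 1 - f 2 else f i

/-- Multiplicities component of `T̃₀`: `(k₁, …, k_m) ↦ (k₁ + k₂, k₃, …, k_m, k₁)`. -/
def Tmult0 (m : ℕ) (g : ℕ → ℤ) : ℕ → ℤ := fun i =>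
  if i = 1 then g 1 + g 2
  else if 2 ≤ i ∧ i < m then g (i + 1)
  else if i = m then g 1 else g i

/-- Parts component of `T̃₁`: `(n₁, …, n_m) ↦ (n₁ − n_m, n₂, …, n_m)`. -/
def Tpart1 (m : ℕ) (f : ℕ → ℤ) : ℕ → ℤ := fun i =>
  if i = 1 then f 1 - f m else f i

/-- Multiplicities component of `T̃₁`: `(k₁, …, k_m) ↦ (k₁, …, k_{m−1}, k₁ + k_m)`. -/
def Tmult1 (m : ℕ) (g : ℕ → ℤ) : ℕ → ℤ := fun i =>
  if i = m then g 1 + g m else g i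

/-- The branch `T̃₀` of the extended slow-Triangle map, acting on pairs of `m`-tuples
(parts, multiplicities), encoded as pairs of functions `ℕ → ℤ` indexed by `1, …, m`. -/
def Ttilde0 (m : ℕ) (p : (ℕ → ℤ) × (ℕ → ℤ)) : (ℕ → ℤ) × (ℕ → ℤ) :=
  (Tpart0 m p.1, Tmult0 m p.2)

/-- The branch `T̃₁` of the extended slow-Triangle map. -/
def Ttilde1 (m : ℕ) (p : (ℕ → ℤ) × (ℕ → ℤ)) : (ℕ → ℤ) × (ℕ → ℤ) :=
  (Tpart1 m p.1, Tmult1 m p.2)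

theorem sum_Icc_one_add_two_eq_first_add_sum_add_last (f : ℕ → ℤ) (k : ℕ) :
    ∑ i ∈ Finset.Icc 1 (k + 2), f i =
      f 1 + ∑ j ∈ Finset.range k, f (j + 2) + f (k + 2) := by
  induction k with
  | zero => simp [Finset.sum_Icc_succ_top]
  | succ k ih =>
    rw [Finset.sum_Icc_succ_top (by omega), ih, Finset.sum_range_succ]
    ring

theorem sum_Icc_one_add_two_eq_first_add_second_add_sum (f : ℕ → ℤ) (k : ℕ) :
    ∑ i ∈ Finset.Icc 1 (k + 2), f i =
      f 1 + f 2 + ∑ j ∈ Finset.range k, f (j + 3) := by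
  induction k with
  | zero => simp [Finset.sum_Icc_succ_top]
  | succ k ih =>
    rw [Finset.sum_Icc_succ_top (by omega), ih, Finset.sum_range_succ]
    ring

/-- `T̃₀` preserves `Σ k_i·n_i`. -/
theorem sum_Tmult0_mul_Tpart0 (m : ℕ) (hm : 2 ≤ m) (f g : ℕ → ℤ) :
    ∑ i ∈ Finset.Icc 1 m, Tmult0 m g i * Tpart0 m f i =
      ∑ i ∈ Finset.Icc 1 m, g i * f i := by
  obtain ⟨k, rfl⟩ := Nat.exists_eq_add_of_le' hm
  rw [sum_Icc_one_add_two_eq_first_add_sum_add_last,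
    sum_Icc_one_add_two_eq_first_add_second_add_sum]
  have hmid : ∑ j ∈ Finset.range k, Tmult0 (k + 2) g (j + 2) * Tpart0 (k + 2) f (j + 2) =
      ∑ j ∈ Finset.range k, g (j + 3) * f (j + 3) := by
    refine Finset.sum_congr rfl fun j hj => ?_
    have hjk := Finset.mem_range.mp hj
    simp [Tmult0, Tpart0, hjk]
  rw [hmid]
  simp [Tmult0, Tpart0]
  ring

/-- `T̃₁` preserves `Σ k_i·n_i`. -/
theorem sum_Tmult1_mul_Tpart1 (m : ℕ) (hm : 2 ≤ m) (f g : ℕ → ℤ) :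
    ∑ i ∈ Finset.Icc 1 m, Tmult1 m g i * Tpart1 m f i =
      ∑ i ∈ Finset.Icc 1 m, g i * f i := by
  obtain ⟨k, rfl⟩ := Nat.exists_eq_add_of_le' hm
  rw [sum_Icc_one_add_two_eq_first_add_sum_add_last,
    sum_Icc_one_add_two_eq_first_add_sum_add_last]
  have hmid : ∑ j ∈ Finset.range k, Tmult1 (k + 2) g (j + 2) * Tpart1 (k + 2) f (j + 2) =
      ∑ j ∈ Finset.range k, g (j + 2) * f (j + 2) := by
    refine Finset.sum_congr rfl fun j hj => ?_
    have hjk := Finset.mem_range.mp hj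
    simp [Tmult1, Tpart1, hjk.ne]
  rw [hmid]
  simp [Tmult1, Tpart1]
  ring

/-- The extended slow-Triangle map sends a partition of `n` to a new partition of `n`:
if `n₁ > ⋯ > n_m > 0`, the `k_i` are nonnegative and `Σ k_i·n_i = n`, then when
`n₂ + n_m > n₁` the image under `T̃₀` again has strictly decreasing positive parts and
total sum `n`, and when `n₂ + n_m < n₁` the same holds for the image under `T̃₁`. -/
theorem triangle_maps_partitions_to_partitions (m : ℕ) (hm : 2 ≤ m) (n : ℤ)
    (p : (ℕ → ℤ) × (ℕ → ℤ))
    (hdec : ∀ i, 1 ≤ i → i < m → p.1 (i + 1) < p.1 i)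
    (hpos : 0 < p.1 m)
    (hk : ∀ i, 1 ≤ i → i ≤ m → 0 ≤ p.2 i)
    (hsum : ∑ i ∈ Finset.Icc 1 m, p.2 i * p.1 i = n) :
    (p.1 1 < p.1 2 + p.1 m →
      (∀ i, 1 ≤ i → i < m → (Ttilde0 m p).1 (i + 1) < (Ttilde0 m p).1 i) ∧
        0 < (Ttilde0 m p).1 m ∧
        ∑ i ∈ Finset.Icc 1 m, (Ttilde0 m p).2 i * (Ttilde0 m p).1 i = n) ∧
    (p.1 2 + p.1 m < p.1 1 →
      (∀ i, 1 ≤ i → i < m → (Ttilde1 m p).1 (i + 1) < (Ttilde1 m p).1 i) ∧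
        0 < (Ttilde1 m p).1 m ∧
        ∑ i ∈ Finset.Icc 1 m, (Ttilde1 m p).2 i * (Ttilde1 m p).1 i = n) := by
  have h21 : p.1 2 < p.1 1 := hdec 1 le_rfl hm
  refine ⟨fun h => ⟨fun i hi him => ?_, ?_, ?_⟩, fun h => ⟨fun i hi him => ?_, ?_, ?_⟩⟩
  · rcases (show i + 1 ≤ m from him).eq_or_lt with rfl | hlt
    · simp only [Ttilde0, Tpart0]
      grind
    · have hstep := hdec (i + 1) (by omega) hlt
      simpa [Ttilde0, Tpart0, hi, him, hlt] using hstep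
  · simpa [Ttilde0, Tpart0] using h21
  · exact (sum_Tmult0_mul_Tpart0 m hm p.1 p.2).trans hsum
  · have hstep := hdec i hi him
    simp only [Ttilde1, Tpart1]
    grind
  · simpa [Ttilde1, Tpart1, show m ≠ 1 by omega] using hpos
  · exact (sum_Tmult1_mul_Tpart1 m hm p.1 p.2).trans hsum
end

section
/- For every m ≥ 3, no vector of the form (k₁, 0, k₃, …, k_m) ∈ ℕ^m with k₁ > 1 (second entry zero, first entry greater than 1) is reachable from (1, 0, …, 0) by a finite composition of μ₀ and μ₁; in particular such a vector is not an allowable multiplicity vector. -/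
/-- The multiplicity map `μ₀ : (k₁, …, k_m) ↦ (k₁ + k₂, k₃, …, k_m, k₁)` of the extended
slow-Triangle map (entries indexed by `1, …, m`; other indices left unchanged). -/
def mu0 (m : ℕ) (g : ℕ → ℕ) : ℕ → ℕ := fun i =>
  if i = 1 then g 1 + g 2
  else if 2 ≤ i ∧ i < m then g (i + 1)
  else if i = m then g 1 else g i

/-- The multiplicity map `μ₁ : (k₁, …, k_m) ↦ (k₁, …, k_{m−1}, k₁ + k_m)`. -/
def mu1 (m : ℕ) (g : ℕ → ℕ) : ℕ → ℕ := fun i =>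
  if i = m then g 1 + g m else g i

/-- The initial multiplicity vector `(1, 0, …, 0)`. -/
def e1 : ℕ → ℕ := fun i => if i = 1 then 1 else 0

/-- A multiplicity vector is reachable if it is the image of `(1, 0, …, 0)` under some
finite composition of `μ₀` and `μ₁`. -/
def Reachable (m : ℕ) (v : ℕ → ℕ) : Prop :=
  ∃ l : List Bool, l.foldl (fun w b => if b then mu1 m w else mu0 m w) e1 = v

/-- The property preserved by `μ₀` and `μ₁`: the first entry is positive, the support within
`2, …, m` is upward closed, and the first entry is `1` whenever the second one vanishes. -/
def SupportInvariant (m : ℕ) (g : ℕ → ℕ) : Prop :=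
  0 < g 1 ∧ (∀ i, 2 ≤ i → i < m → 0 < g i → 0 < g (i + 1)) ∧ (g 2 = 0 → g 1 = 1)

lemma supportInvariant_e1 (m : ℕ) : SupportInvariant m e1 := by
  refine ⟨by simp [e1], fun i hi _ h => ?_, fun _ => by simp [e1]⟩
  have : i ≠ 1 := by omega
  simp [e1, this] at h

lemma SupportInvariant.mu0 {m : ℕ} (hm : 3 ≤ m) {g : ℕ → ℕ} (hg : SupportInvariant m g) :
    SupportInvariant m (mu0 m g) := by
  obtain ⟨hpos, hup, hone⟩ := hg
  have hfst : _root_.mu0 m g 1 = g 1 + g 2 := by simp [_root_.mu0]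
  have hmid : ∀ i, 2 ≤ i → i < m → _root_.mu0 m g i = g (i + 1) := fun i hi him => by
    simp [_root_.mu0, hi, him, show i ≠ 1 by omega]
  have hlast : _root_.mu0 m g m = g 1 := by simp [_root_.mu0, show m ≠ 1 by omega]
  refine ⟨by omega, fun i hi him h => ?_, fun h => ?_⟩
  · rw [hmid i hi him] at h
    obtain him' | rfl : i + 1 < m ∨ i + 1 = m := by omega
    · rw [hmid (i + 1) (by omega) him']
      exact hup (i + 1) (by omega) him' h
    · rwa [hlast]
  · rw [hmid 2 le_rfl (by omega)] at h
    have := hup 2 le_rfl (by omega)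
    simp only [Nat.reduceAdd] at this h
    omega

lemma SupportInvariant.mu1 {m : ℕ} (hm : 3 ≤ m) {g : ℕ → ℕ} (hg : SupportInvariant m g) :
    SupportInvariant m (mu1 m g) := by
  obtain ⟨hpos, hup, hone⟩ := hg
  have hlt : ∀ i, i < m → _root_.mu1 m g i = g i := fun i him => by
    simp [_root_.mu1, him.ne]
  have hlast : _root_.mu1 m g m = g 1 + g m := by simp [_root_.mu1]
  refine ⟨by rwa [hlt 1 (by omega)], fun i hi him h => ?_, ?_⟩
  · rw [hlt i him] at h
    obtain him' | rfl : i + 1 < m ∨ i + 1 = m := by omega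
    · rw [hlt (i + 1) him']
      exact hup i hi him h
    · rw [hlast]
      omega
  · rwa [hlt 1 (by omega), hlt 2 (by omega)]

lemma SupportInvariant.foldl {m : ℕ} (hm : 3 ≤ m) (l : List Bool) {g : ℕ → ℕ}
    (hg : SupportInvariant m g) :
    SupportInvariant m
      (l.foldl (fun w b => if b then _root_.mu1 m w else _root_.mu0 m w) g) := by
  induction l generalizing g with
  | nil => exact hg
  | cons b l ih =>
    cases b
    · exact ih (hg.mu0 hm)
    · exact ih (hg.mu1 hm)

/-- No vector of the form `(k₁, 0, k₃, …, k_m)` with `k₁ > 1` (second entry zero, first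
entry greater than 1) is reachable: it is not an allowable multiplicity vector. -/
theorem not_reachable_second_zero (m : ℕ) (hm : 3 ≤ m) (v : ℕ → ℕ)
    (h1 : 1 < v 1) (h2 : v 2 = 0) : ¬ Reachable m v := by
  rintro ⟨l, rfl⟩
  exact h1.ne' (((supportInvariant_e1 m).foldl hm l).2.2 h2)
end

section
/- For every m ≥ 3, no vector of the form (k₁, k₂, …, k_{m−1}, 0) ∈ ℕ^m with k₂ > 0 (last entry zero, second entry positive) is reachable from (1, 0, …, 0) by a finite composition of μ₀ and μ₁; in particular such a vector is not an allowable multiplicity vector. -/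
/-- Along any composition of `μ₀` and `μ₁`, the first entry stays positive, and the last entry
is positive unless the second one vanishes. -/
theorem foldl_first_pos_and_last_pos (m : ℕ) (hm : 3 ≤ m) (l : List Bool) (w : ℕ → ℕ)
    (hw : 0 < w 1 ∧ (w 2 = 0 ∨ 0 < w m)) :
    0 < l.foldl (fun w b => if b then mu1 m w else mu0 m w) w 1 ∧
      (l.foldl (fun w b => if b then mu1 m w else mu0 m w) w 2 = 0 ∨
        0 < l.foldl (fun w b => if b then mu1 m w else mu0 m w) w m) := by
  induction l generalizing w with
  | nil => exact hw
  | cons b l ih =>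
    refine ih _ ?_
    have h1m : 1 ≠ m := by omega
    have hm1 : m ≠ 1 := by omega
    cases b
    · simp [mu0, hm1, hw.1]
    · simp [mu1, h1m, hw.1]

/-- No vector of the form `(k₁, k₂, …, k_{m−1}, 0)` with `k₂ > 0` (last entry zero,
second entry positive) is reachable: it is not an allowable multiplicity vector. -/
theorem not_reachable_last_zero (m : ℕ) (hm : 3 ≤ m) (v : ℕ → ℕ)
    (h1 : 0 < v 2) (h2 : v m = 0) : ¬ Reachable m v := by
  rintro ⟨l, rfl⟩
  have h := foldl_first_pos_and_last_pos m hm l e1 (by simp [e1])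
  omega
end

section
/- For every m ≥ 3, no vector of the form (k, k₂, …, k_{m−1}, k) ∈ ℕ^m with k ≥ 2 (equal first and last entries, both at least 2) is reachable from (1, 0, …, 0) by a finite composition of μ₀ and μ₁; in particular such a vector is not an allowable multiplicity vector. (For example, the partition (5, 4, 3) × [2, 1, 2] of 20 cannot be obtained from any (20, n₂, n₃) × [1, 0, 0] by the extended slow-Triangle map.) -/
/-- An invariant of both multiplicity maps: the zeros among the entries `2, …, m` form an initial
segment, and the first entry is `1` as long as the second or the last entry vanishes, or the first
and last entries agree. -/
structure MultiplicityInvariant (m : ℕ) (g : ℕ → ℕ) : Prop where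
  first_pos : 1 ≤ g 1
  zero_of_succ : ∀ i, 2 ≤ i → i < m → g (i + 1) = 0 → g i = 0
  first_of_second : g 2 = 0 → g 1 = 1
  first_of_last : g m = 0 → g 1 = 1
  first_of_eq : g 1 = g m → g 1 = 1

namespace MultiplicityInvariant

variable {m : ℕ} {g : ℕ → ℕ}

theorem e1 : MultiplicityInvariant m e1 := by
  constructor <;> simp [_root_.e1]; omega

theorem mu0 (hm : 3 ≤ m) (h : MultiplicityInvariant m g) :
    MultiplicityInvariant m (mu0 m g) := by
  obtain ⟨hpos, hsucc, hsecond, hlast, heq⟩ := h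
  have first : _root_.mu0 m g 1 = g 1 + g 2 := by simp [_root_.mu0]
  have mid : ∀ i, 2 ≤ i → i < m → _root_.mu0 m g i = g (i + 1) := fun i hi him => by
    simp [_root_.mu0, hi, him, show i ≠ 1 by omega]
  have last : _root_.mu0 m g m = g 1 := by simp [_root_.mu0, show m ≠ 1 by omega]
  refine ⟨by omega, fun i hi him hz => ?_, fun hz => ?_, by omega, by omega⟩
  · rcases Nat.lt_or_ge (i + 1) m with hlt | hge
    · rw [mid _ (by omega) hlt] at hz
      rw [mid i hi him]
      exact hsucc _ (by omega) hlt hz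
    · rw [show i + 1 = m by omega] at hz
      omega
  · rw [mid 2 le_rfl hm] at hz
    have := hsucc 2 le_rfl hm hz
    omega

theorem mu1 (hm : 3 ≤ m) (h : MultiplicityInvariant m g) :
    MultiplicityInvariant m (mu1 m g) := by
  obtain ⟨hpos, hsucc, hsecond, hlast, heq⟩ := h
  have init : ∀ i, i < m → _root_.mu1 m g i = g i := fun i hi => by
    simp [_root_.mu1, hi.ne]
  have last : _root_.mu1 m g m = g 1 + g m := by simp [_root_.mu1]
  have first := init 1 (by omega)
  have second := init 2 (by omega)
  refine ⟨by omega, fun i hi him hz => ?_, by omega, by omega, by omega⟩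
  rcases Nat.lt_or_ge (i + 1) m with hlt | hge
  · rw [init _ hlt] at hz
    rw [init i him]
    exact hsucc i hi him hz
  · rw [show i + 1 = m by omega] at hz
    omega

theorem foldl (hm : 3 ≤ m) (l : List Bool) (h : MultiplicityInvariant m g) :
    MultiplicityInvariant m
      (l.foldl (fun w b => if b then _root_.mu1 m w else _root_.mu0 m w) g) := by
  induction l generalizing g with
  | nil => exact h
  | cons b l ih =>
    cases b
    · exact ih (h.mu0 hm)
    · exact ih (h.mu1 hm)

end MultiplicityInvariant

/-- No vector of the form `(k, k₂, …, k_{m−1}, k)` with `k ≥ 2` (equal first and last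
entries, both at least 2) is reachable: it is not an allowable multiplicity vector. -/
theorem not_reachable_equal_ends (m : ℕ) (hm : 3 ≤ m) (v : ℕ → ℕ)
    (h1 : 2 ≤ v 1) (h2 : v 1 = v m) : ¬ Reachable m v := by
  rintro ⟨l, rfl⟩
  have := (MultiplicityInvariant.e1.foldl hm l).first_of_eq h2
  omega
end
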